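/- Let v be α-quasiperiodic, C² on the closure of Ω_R, with v = 0 on Γ, and let c ∈ ℝ be a constant. Then 2·Re ∫_{Ω_R} (x₂−c)·∂₂v̄·(Δv + k²v) dx + ∫_Γ (x₂−c)·ν₂·|∂_ν v|² ds + 2∫_{Ω_R} |∂₂v|² dx = (R−c)·∫₀^{2π} ( |∂₂v(x₁,R)|² − |∂₁v(x₁,R)|² + k²|v(x₁,R)|² ) dx₁ + ∫_{Ω_R} ( |∇v|² − k²|v|² ) dx, where ν = (ν₁,ν₂) = (−f′(x₁),1)/√(1+f′(x₁)²) is the unit normal on Γ pointing into Ω_R. -/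

import Mathlib

open MeasureTheory Real Set

noncomputable section

/-- Partial derivative in the `x₁` direction. -/
def p1 (u : ℝ × ℝ → ℂ) (x : ℝ × ℝ) : ℂ := fderiv ℝ u x (1, 0)

/-- Partial derivative in the `x₂` direction. -/
def p2 (u : ℝ × ℝ → ℂ) (x : ℝ × ℝ) : ℂ := fderiv ℝ u x (0, 1)

/-- Laplacian of a function on `ℝ²`. -/
def lap (u : ℝ × ℝ → ℂ) (x : ℝ × ℝ) : ℂ := p1 (p1 u) x + p2 (p2 u) x

/-- The coefficients `β_n`: `β_n = √(k² − (n+α)²)` if `|n+α| ≤ k`, `β_n = i√((n+α)² − k²)`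
otherwise. -/
def betan (k α : ℝ) (n : ℤ) : ℂ :=
  if |(n : ℝ) + α| ≤ k then ((Real.sqrt (k ^ 2 - ((n : ℝ) + α) ^ 2) : ℝ) : ℂ)
  else Complex.I * ((Real.sqrt (((n : ℝ) + α) ^ 2 - k ^ 2) : ℝ) : ℂ)

/-- `α`-quasiperiodicity: `u(x₁ + 2π, x₂) = e^{2πiα} u(x₁, x₂)`. -/
def QP (α : ℝ) (u : ℝ × ℝ → ℂ) : Prop :=
  ∀ x : ℝ × ℝ, u (x.1 + 2 * π, x.2) = Complex.exp (((2 * π * α : ℝ) : ℂ) * Complex.I) * u x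

/-- `Γ_max = max_{0 ≤ t ≤ 2π} f(t)`. -/
def GammaMax (f : ℝ → ℝ) : ℝ := sSup (f '' Icc 0 (2 * π))

/-- `Γ_min = min_{0 ≤ t ≤ 2π} f(t)`. -/
def GammaMin (f : ℝ → ℝ) : ℝ := sInf (f '' Icc 0 (2 * π))

/-- The truncated periodic cell `Ω_R = {(x₁,x₂) : f(x₁) < x₂ < R, 0 < x₁ < 2π}`. -/
def OmegaR (f : ℝ → ℝ) (R : ℝ) : Set (ℝ × ℝ) :=
  {x | 0 < x.1 ∧ x.1 < 2 * π ∧ f x.1 < x.2 ∧ x.2 < R}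

/-- The incident plane wave `u^i(x) = γ e^{i(αx₁ − βx₂)}`, `α = k sin θ`, `β = k cos θ`. -/
def ui (k θ : ℝ) (γ : ℂ) (x : ℝ × ℝ) : ℂ :=
  γ * Complex.exp (Complex.I * ((k * Real.sin θ * x.1 - k * Real.cos θ * x.2 : ℝ) : ℂ))

/-- The upward (outgoing) Rayleigh series `Σₙ cₙ e^{i(αₙ x₁ + βₙ x₂)}` with `αₙ = n + α`. -/
def ray (k α : ℝ) (c : ℤ → ℂ) (x : ℝ × ℝ) : ℂ :=
  ∑' n : ℤ, c n * Complex.exp (Complex.I * ((((n : ℝ) + α) * x.1 : ℝ) : ℂ)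
    + Complex.I * betan k α n * (x.2 : ℂ))

/-- The normal derivative `∂_ν u` on the grating profile `Γ`, with
`ν = (−f′(x₁), 1)/√(1 + f′(x₁)²)`. -/
def dnu (f : ℝ → ℝ) (u : ℝ × ℝ → ℂ) (x₁ : ℝ) : ℂ :=
  (((-(deriv f x₁) : ℝ) : ℂ) * p1 u (x₁, f x₁) + p2 u (x₁, f x₁)) /
    ((Real.sqrt (1 + (deriv f x₁) ^ 2) : ℝ) : ℂ)

/-- The squared energy norm `‖u‖²_{X_R} = k²‖u‖²_{L²(Ω_R)} + ‖∇u‖²_{L²(Ω_R)}`. -/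
def XRnorm2 (k : ℝ) (f : ℝ → ℝ) (R : ℝ) (u : ℝ × ℝ → ℂ) : ℝ :=
  k ^ 2 * (∫ x in OmegaR f R, ‖u x‖ ^ 2) + ∫ x in OmegaR f R, (‖p1 u x‖ ^ 2 + ‖p2 u x‖ ^ 2)

open scoped RealInnerProductSpace

theorem hasDerivAt_integral_fst {F : ℝ × ℝ → ℝ} (hF : ContDiff ℝ 1 F) (a b x : ℝ) :
    HasDerivAt (fun x => ∫ t in a..b, F (x, t)) (∫ t in a..b, fderiv ℝ F (x, t) (1, 0)) x := by
  have hcont : Continuous fun p : ℝ × ℝ => fderiv ℝ F p (1, 0) :=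
    (hF.continuous_fderiv one_ne_zero).clm_apply continuous_const
  obtain ⟨C, hC⟩ := ((isCompact_closedBall x 1).prod
    (isCompact_uIcc (a := a) (b := b))).bddAbove_image hcont.norm.continuousOn
  refine (intervalIntegral.hasDerivAt_integral_of_dominated_loc_of_deriv_le (bound := fun _ => C)
    (F' := fun x t => fderiv ℝ F (x, t) (1, 0))
    (Metric.closedBall_mem_nhds x one_pos) (.of_forall fun y => ?_) ?_ ?_ ?_ ?_ ?_).2
  · exact (hF.continuous.comp (by fun_prop : Continuous fun t => (y, t))).aestronglyMeasurable
  · exact (hF.continuous.comp (by fun_prop : Continuous fun t => (x, t))).intervalIntegrable _ _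
  · exact (hcont.comp (by fun_prop : Continuous fun t => (x, t))).aestronglyMeasurable
  · refine .of_forall fun t ht y hy => hC ⟨(y, t), ⟨hy, Set.uIoc_subset_uIcc ht⟩, rfl⟩
  · exact intervalIntegrable_const
  · refine .of_forall fun t _ y _ => ?_
    exact ((hF.differentiable one_ne_zero) (y, t)).hasFDerivAt.comp_hasDerivAt y
      ((hasDerivAt_id y).prodMk (hasDerivAt_const y t))

/-- Leibniz rule with a variable lower endpoint. -/
theorem hasDerivAt_integral_lower {F : ℝ × ℝ → ℝ} (hF : ContDiff ℝ 1 F) {f : ℝ → ℝ} {f' x : ℝ}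
    (hf : HasDerivAt f f' x) (R : ℝ) :
    HasDerivAt (fun x => ∫ t in f x..R, F (x, t))
      ((∫ t in f x..R, fderiv ℝ F (x, t) (1, 0)) - f' * F (x, f x)) x := by
  have hcont : Continuous fun p : ℝ × ℝ => fderiv ℝ F p (1, 0) :=
    (hF.continuous_fderiv one_ne_zero).clm_apply continuous_const
  have hprim : Continuous fun p : ℝ × ℝ => ∫ t in p.2..R, fderiv ℝ F (p.1, t) (1, 0) := by
    exact (intervalIntegral.continuous_parametric_primitive_of_continuous
      (f := fun x t => fderiv ℝ F (x, t) (1, 0)) hcont).neg.congr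
      fun p => (intervalIntegral.integral_symm R p.2).symm
  have hG := hasStrictFDerivAt_uncurry_coprod (𝕜 := ℝ) (u := (x, f x))
    (f := fun x s => ∫ t in s..R, F (x, t))
    (f₁ := fun x s => ContinuousLinearMap.toSpanSingleton ℝ
      (∫ t in s..R, fderiv ℝ F (x, t) (1, 0)))
    (f₂ := fun x s => ContinuousLinearMap.toSpanSingleton ℝ (-F (x, s)))
    (.of_forall fun p => (hasDerivAt_integral_fst hF p.2 R p.1).hasFDerivAt)
    (.of_forall fun p => ?_)
    ?_ ?_
  · have := hG.hasFDerivAt.comp_hasDerivAt x ((hasDerivAt_id x).prodMk hf)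
    refine this.congr_deriv ?_
    simp [Function.HasUncurry.uncurry]
    ring
  · have hc : Continuous fun t => F (p.1, t) := hF.continuous.comp (by fun_prop)
    exact (intervalIntegral.integral_hasDerivAt_left (hc.intervalIntegrable _ _)
      (hc.stronglyMeasurableAtFilter _ _) hc.continuousAt).hasFDerivAt
  · exact ((ContinuousLinearMap.toSpanSingletonCLE (𝕜 := ℝ) (E := ℝ)).continuous.comp
      hprim).continuousAt
  · exact ((ContinuousLinearMap.toSpanSingletonCLE (𝕜 := ℝ) (E := ℝ)).continuous.comp
      hF.continuous.neg).continuousAt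

theorem measurableSet_OmegaR {f : ℝ → ℝ} (hf : Continuous f) (R : ℝ) :
    MeasurableSet (OmegaR f R) := by
  refine IsOpen.measurableSet ?_
  exact (isOpen_lt continuous_const continuous_fst).inter
    ((isOpen_lt continuous_fst continuous_const).inter
      ((isOpen_lt (hf.comp continuous_fst) continuous_snd).inter
        (isOpen_lt continuous_snd continuous_const)))

theorem integrableOn_OmegaR {E : Type*} [NormedAddCommGroup E] {f : ℝ → ℝ} (hf : Continuous f)
    (R : ℝ) {g : ℝ × ℝ → E} (hg : Continuous g) : IntegrableOn g (OmegaR f R) := by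
  obtain ⟨m, hm⟩ := (isCompact_Icc.image hf : IsCompact (f '' Icc 0 (2 * π))).bddBelow
  refine (hg.continuousOn.integrableOn_compact
    ((isCompact_Icc (a := 0) (b := 2 * π)).prod (isCompact_Icc (a := m) (b := R)))).mono_set ?_
  rintro ⟨x, y⟩ ⟨h0, h1, h2, h3⟩
  exact ⟨⟨h0.le, h1.le⟩, (hm ⟨x, ⟨h0.le, h1.le⟩, rfl⟩).trans h2.le, h3.le⟩

theorem setIntegral_OmegaR {f : ℝ → ℝ} (hf : Continuous f) {R : ℝ}
    (hR : ∀ x ∈ Icc 0 (2 * π), f x < R) {g : ℝ × ℝ → ℝ} (hg : Continuous g) :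
    ∫ x in OmegaR f R, g x = ∫ x in Ioo 0 (2 * π), ∫ y in f x..R, g (x, y) := by
  have hmeas := measurableSet_OmegaR hf R
  rw [← integral_indicator hmeas, Measure.volume_eq_prod,
    integral_prod _ ((integrableOn_OmegaR hf R hg).integrable_indicator hmeas),
    ← integral_indicator measurableSet_Ioo]
  congr 1 with x
  by_cases hx : x ∈ Ioo 0 (2 * π)
  · rw [indicator_of_mem hx, intervalIntegral.integral_of_le (hR x ⟨hx.1.le, hx.2.le⟩).le,
      integral_Ioc_eq_integral_Ioo, ← integral_indicator measurableSet_Ioo]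
    congr 1 with y
    exact indicator_eq_indicator (by simp [OmegaR, hx.1, hx.2]) rfl
  · rw [indicator_of_notMem hx]
    refine integral_eq_zero_of_ae (.of_forall fun y => indicator_of_notMem ?_ _)
    exact fun h => hx ⟨h.1, h.2.1⟩

theorem setIntegral_OmegaR_fderiv_snd {f : ℝ → ℝ} (hf : Continuous f) {R : ℝ}
    (hR : ∀ x ∈ Icc 0 (2 * π), f x < R) {F : ℝ × ℝ → ℝ} (hF : ContDiff ℝ 1 F) :
    ∫ x in OmegaR f R, fderiv ℝ F x (0, 1) =
      ∫ x in Ioo 0 (2 * π), (F (x, R) - F (x, f x)) := by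
  have hcont : Continuous fun p : ℝ × ℝ => fderiv ℝ F p (0, 1) :=
    (hF.continuous_fderiv one_ne_zero).clm_apply continuous_const
  rw [setIntegral_OmegaR hf hR hcont]
  congr 1 with x
  refine intervalIntegral.integral_eq_sub_of_hasDerivAt (f := fun y => F (x, y)) (fun y _ => ?_)
    ((hcont.comp (by fun_prop : Continuous fun y => (x, y))).intervalIntegrable _ _)
  exact ((hF.differentiable one_ne_zero) (x, y)).hasFDerivAt.comp_hasDerivAt y
    ((hasDerivAt_const y x).prodMk (hasDerivAt_id y))

theorem setIntegral_OmegaR_fderiv_fst {f : ℝ → ℝ} (hf : ContDiff ℝ 1 f) {R : ℝ}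
    (hfper : f (2 * π) = f 0) (hR : ∀ x ∈ Icc 0 (2 * π), f x < R) {F : ℝ × ℝ → ℝ}
    (hF : ContDiff ℝ 1 F) (hFper : ∀ y, F (2 * π, y) = F (0, y)) :
    ∫ x in OmegaR f R, fderiv ℝ F x (1, 0) = ∫ x in Ioo 0 (2 * π), deriv f x * F (x, f x) := by
  have hcont : Continuous fun p : ℝ × ℝ => fderiv ℝ F p (1, 0) :=
    (hF.continuous_fderiv one_ne_zero).clm_apply continuous_const
  have hfc := hf.continuous
  have hFc := hF.continuous
  have hdf : Continuous (deriv f) := hf.continuous_deriv le_rfl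
  have hI : Continuous fun x => ∫ t in f x..R, fderiv ℝ F (x, t) (1, 0) := by
    exact (intervalIntegral.continuous_parametric_intervalIntegral_of_continuous
      (f := fun x t => fderiv ℝ F (x, t) (1, 0)) hcont hfc).neg.congr
      fun x => (intervalIntegral.integral_symm R (f x)).symm
  have hB : Continuous fun x => deriv f x * F (x, f x) := by fun_prop
  have key := intervalIntegral.integral_eq_sub_of_hasDerivAt (a := 0) (b := 2 * π)
    (fun x _ => hasDerivAt_integral_lower hF
      ((hf.differentiable one_ne_zero) x).hasDerivAt R)
    ((hI.sub hB).intervalIntegrable _ _)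
  rw [hfper, intervalIntegral.integral_sub (hI.intervalIntegrable _ _)
    (hB.intervalIntegrable _ _)] at key
  simp_rw [hFper, sub_self] at key
  rw [setIntegral_OmegaR hfc hR hcont, ← integral_Ioc_eq_integral_Ioo,
    ← integral_Ioc_eq_integral_Ioo, ← intervalIntegral.integral_of_le two_pi_pos.le,
    ← intervalIntegral.integral_of_le two_pi_pos.le]
  linarith

theorem contDiff_p1 {v : ℝ × ℝ → ℂ} {n : ℕ} (hv : ContDiff ℝ (n + 1) v) : ContDiff ℝ n (p1 v) :=
  (hv.fderiv_right le_rfl).clm_apply contDiff_const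

theorem contDiff_p2 {v : ℝ × ℝ → ℂ} {n : ℕ} (hv : ContDiff ℝ (n + 1) v) : ContDiff ℝ n (p2 v) :=
  (hv.fderiv_right le_rfl).clm_apply contDiff_const

theorem p1_p2_comm {v : ℝ × ℝ → ℂ} (hv : ContDiff ℝ 2 v) (x : ℝ × ℝ) :
    p1 (p2 v) x = p2 (p1 v) x := by
  have hd : DifferentiableAt ℝ (fderiv ℝ v) x :=
    (hv.fderiv_right (m := 1) le_rfl).differentiable one_ne_zero x
  have h := (hv.contDiffAt (x := x)).isSymmSndFDerivAt (by simp) (1, 0) (0, 1)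
  unfold p1 p2
  rw [fderiv_clm_apply hd (differentiableAt_const _),
    fderiv_clm_apply hd (differentiableAt_const _)]
  simpa using h

theorem fderiv_QP {α : ℝ} {v : ℝ × ℝ → ℂ} (hv : Differentiable ℝ v) (hqp : QP α v) (x : ℝ × ℝ) :
    fderiv ℝ v (x.1 + 2 * π, x.2) =
      Complex.exp (((2 * π * α : ℝ) : ℂ) * Complex.I) • fderiv ℝ v x := by
  have h : (fun x => v (x + (2 * π, 0))) =
      Complex.exp (((2 * π * α : ℝ) : ℂ) * Complex.I) • v := by
    ext x
    simpa [Prod.add_def] using hqp x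
  have h' := congrArg (fun u => fderiv ℝ u x) h
  simp only [fderiv_comp_add_right] at h'
  rw [fderiv_const_smul (hv x)] at h'
  rw [← h']
  congr 1
  ext <;> simp

theorem inner_mul_left_of_norm_eq_one {e : ℂ} (he : ‖e‖ = 1) (a b : ℂ) :
    ⟪e * a, e * b⟫ = ⟪a, b⟫ := by
  have h : e.re * e.re + e.im * e.im = 1 := by
    rw [← Complex.normSq_apply, Complex.normSq_eq_norm_sq, he, one_pow]
  simp only [Complex.inner, Complex.mul_re, Complex.mul_im, Complex.conj_re, Complex.conj_im]
  linear_combination (a.re * b.re + a.im * b.im) * h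

/-- The tangential derivative vanishes along a graph on which `v` vanishes. -/
theorem p1_graph_eq {f : ℝ → ℝ} (hf : Differentiable ℝ f) {v : ℝ × ℝ → ℂ}
    (hv : Differentiable ℝ v) {s : Set ℝ} (hs : IsOpen s) (hv0 : ∀ x ∈ s, v (x, f x) = 0)
    {x : ℝ} (hx : x ∈ s) : p1 v (x, f x) = -(deriv f x * p2 v (x, f x)) := by
  have h1 := (hv (x, f x)).hasFDerivAt.comp_hasDerivAt x
    ((hasDerivAt_id x).prodMk (hf x).hasDerivAt)
  have h2 : HasDerivAt (fun x => v (x, f x)) 0 x :=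
    (hasDerivAt_const x (0 : ℂ)).congr_of_eventuallyEq
      (Filter.eventuallyEq_of_mem (hs.mem_nhds hx) hv0)
  have h3 := h1.unique h2
  have h4 : ((1 : ℝ), deriv f x) = (1, 0) + deriv f x • ((0 : ℝ), (1 : ℝ)) := by
    ext <;> simp
  rw [h4, map_add, map_smul, Complex.real_smul] at h3
  exact eq_neg_of_add_eq_zero_left h3

/-- First component of the field whose divergence gives the Rellich identity. -/
def rellichFst (c : ℝ) (v : ℝ × ℝ → ℂ) (x : ℝ × ℝ) : ℝ :=
  2 * (x.2 - c) * ⟪p2 v x, p1 v x⟫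

/-- Second component of the field whose divergence gives the Rellich identity. -/
def rellichSnd (k c : ℝ) (v : ℝ × ℝ → ℂ) (x : ℝ × ℝ) : ℝ :=
  (x.2 - c) * (‖p2 v x‖ ^ 2 - ‖p1 v x‖ ^ 2 + k ^ 2 * ‖v x‖ ^ 2)

theorem contDiff_rellichFst (c : ℝ) {v : ℝ × ℝ → ℂ} (hv : ContDiff ℝ 2 v) :
    ContDiff ℝ 1 (rellichFst c v) := by
  have h1 : ContDiff ℝ 1 (p1 v) := contDiff_p1 (n := 1) hv
  have h2 : ContDiff ℝ 1 (p2 v) := contDiff_p2 (n := 1) hv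
  exact (contDiff_const.mul (contDiff_snd.sub contDiff_const)).mul (h2.inner ℝ h1)

theorem contDiff_rellichSnd (k c : ℝ) {v : ℝ × ℝ → ℂ} (hv : ContDiff ℝ 2 v) :
    ContDiff ℝ 1 (rellichSnd k c v) := by
  have h1 : ContDiff ℝ 1 (p1 v) := contDiff_p1 (n := 1) hv
  have h2 : ContDiff ℝ 1 (p2 v) := contDiff_p2 (n := 1) hv
  have h0 : ContDiff ℝ 1 v := hv.of_le one_le_two
  exact (contDiff_snd.sub contDiff_const).mul
    (((h2.norm_sq ℝ).sub (h1.norm_sq ℝ)).add (contDiff_const.mul (h0.norm_sq ℝ)))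

theorem fderiv_rellichFst (c : ℝ) {v : ℝ × ℝ → ℂ} (hv : ContDiff ℝ 2 v) (x : ℝ × ℝ) :
    fderiv ℝ (rellichFst c v) x (1, 0) =
      2 * (x.2 - c) * (⟪p2 v x, p1 (p1 v) x⟫ + ⟪p1 (p2 v) x, p1 v x⟫) := by
  have h1 := ((contDiff_p1 (n := 1) hv).differentiable one_ne_zero x).hasFDerivAt
  have h2 := ((contDiff_p2 (n := 1) hv).differentiable one_ne_zero x).hasFDerivAt
  have h : HasFDerivAt (rellichFst c v) _ x :=
    (((hasFDerivAt_snd (𝕜 := ℝ) (p := x)).sub_const c).const_mul 2).mul (h2.inner ℝ h1)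
  rw [h.fderiv]
  simp [p1]

theorem fderiv_rellichSnd (k c : ℝ) {v : ℝ × ℝ → ℂ} (hv : ContDiff ℝ 2 v) (x : ℝ × ℝ) :
    fderiv ℝ (rellichSnd k c v) x (0, 1) =
      (x.2 - c) * (2 * ⟪p2 v x, p2 (p2 v) x⟫ - 2 * ⟪p1 v x, p2 (p1 v) x⟫
        + k ^ 2 * (2 * ⟪v x, p2 v x⟫))
      + (‖p2 v x‖ ^ 2 - ‖p1 v x‖ ^ 2 + k ^ 2 * ‖v x‖ ^ 2) := by
  have h1 := ((contDiff_p1 (n := 1) hv).differentiable one_ne_zero x).hasFDerivAt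
  have h2 := ((contDiff_p2 (n := 1) hv).differentiable one_ne_zero x).hasFDerivAt
  have h0 := (hv.differentiable two_ne_zero x).hasFDerivAt
  have h : HasFDerivAt (rellichSnd k c v) _ x :=
    ((hasFDerivAt_snd (𝕜 := ℝ) (p := x)).sub_const c).mul
      ((h2.norm_sq.sub h1.norm_sq).add (h0.norm_sq.const_mul (k ^ 2)))
  rw [h.fderiv]
  simp [p2]
  ring

/-- Pointwise form of the Rellich identity. -/
theorem rellich_pointwise (k c : ℝ) {v : ℝ × ℝ → ℂ} (hv : ContDiff ℝ 2 v) (x : ℝ × ℝ) :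
    2 * (((x.2 - c : ℝ) : ℂ) * (starRingEnd ℂ) (p2 v x) * (lap v x + (k : ℂ) ^ 2 * v x)).re
        + 2 * ‖p2 v x‖ ^ 2 =
      fderiv ℝ (rellichFst c v) x (1, 0) + fderiv ℝ (rellichSnd k c v) x (0, 1)
        + (‖p1 v x‖ ^ 2 + ‖p2 v x‖ ^ 2 - k ^ 2 * ‖v x‖ ^ 2) := by
  rw [fderiv_rellichFst c hv, fderiv_rellichSnd k c hv, p1_p2_comm hv, lap]
  simp only [← Complex.ofReal_pow, Complex.inner, Complex.mul_re, Complex.mul_im, Complex.conj_re,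
    Complex.conj_im, Complex.add_re, Complex.add_im, Complex.ofReal_re, Complex.ofReal_im]
  ring

theorem rellichFst_periodic {α : ℝ} (c : ℝ) {v : ℝ × ℝ → ℂ} (hv : Differentiable ℝ v)
    (hqp : QP α v) (y : ℝ) : rellichFst c v (2 * π, y) = rellichFst c v (0, y) := by
  have h := fderiv_QP hv hqp (0, y)
  simp only [zero_add] at h
  simp only [rellichFst, p1, p2, h, smul_apply, smul_eq_mul]
  rw [inner_mul_left_of_norm_eq_one (Complex.norm_exp_ofReal_mul_I _)]

theorem rellich_boundary (k c : ℝ) {f : ℝ → ℝ} {v : ℝ × ℝ → ℂ} {x : ℝ}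
    (h0 : v (x, f x) = 0) (h1 : p1 v (x, f x) = -(deriv f x * p2 v (x, f x))) :
    ((f x - c) * (1 / Real.sqrt (1 + deriv f x ^ 2)) * ‖dnu f v x‖ ^ 2) *
        Real.sqrt (1 + deriv f x ^ 2) =
      rellichSnd k c v (x, f x) - deriv f x * rellichFst c v (x, f x) := by
  have hpos : 0 < 1 + deriv f x ^ 2 := by positivity
  have hne : Real.sqrt (1 + deriv f x ^ 2) ≠ 0 := (Real.sqrt_pos.2 hpos).ne'
  have hd : dnu f v x = ((1 + deriv f x ^ 2 : ℝ) : ℂ) * p2 v (x, f x) /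
      ((Real.sqrt (1 + (deriv f x) ^ 2) : ℝ) : ℂ) := by
    rw [dnu, h1]
    push_cast
    ring
  have hn : ‖dnu f v x‖ ^ 2 = (1 + deriv f x ^ 2) * ‖p2 v (x, f x)‖ ^ 2 := by
    rw [hd, norm_div, norm_mul, Complex.norm_real, Complex.norm_real, div_pow, mul_pow,
      Real.norm_eq_abs, Real.norm_eq_abs, sq_abs, sq_abs, Real.sq_sqrt hpos.le]
    field_simp
  have hi : ⟪p2 v (x, f x), p1 v (x, f x)⟫ = -(deriv f x * ‖p2 v (x, f x)‖ ^ 2) := by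
    rw [h1, inner_neg_right, ← Complex.real_smul, inner_smul_right, real_inner_self_eq_norm_sq]
  have ha : ‖p1 v (x, f x)‖ ^ 2 = deriv f x ^ 2 * ‖p2 v (x, f x)‖ ^ 2 := by
    rw [h1, norm_neg, norm_mul, mul_pow, Complex.norm_real, Real.norm_eq_abs, sq_abs]
  rw [hn, rellichSnd, rellichFst, hi, ha, h0, norm_zero]
  field_simp
  ring

/-- Corollary 6.2 of the paper: the Rellich identity for an `α`-quasiperiodic
function `v`, `C²` up to the closure of `Ω_R`, vanishing on `Γ`, where
`ν = (−f′,1)/√(1+f′²)` is the unit normal on `Γ` pointing into `Ω_R` and integrals over `Γ`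
carry the arclength weight `√(1+f′²)`. -/
theorem rellich_identity_dirichlet
    (f : ℝ → ℝ) (hfper : ∀ t, f (t + 2 * π) = f t) (hf : ContDiff ℝ 1 f)
    (k α c : ℝ) (hk : 0 < k)
    (R : ℝ) (hR : GammaMax f < R)
    (v : ℝ × ℝ → ℂ) (hv : ContDiff ℝ 2 v) (hvqp : QP α v)
    (hv0 : ∀ x₁ ∈ Ioo (0 : ℝ) (2 * π), v (x₁, f x₁) = 0) :
    2 * (∫ x in OmegaR f R,
          ((x.2 - c : ℝ) : ℂ) * (starRingEnd ℂ) (p2 v x) * (lap v x + (k : ℂ) ^ 2 * v x)).re +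
      (∫ x₁ in Ioo (0 : ℝ) (2 * π),
        ((f x₁ - c) * (1 / Real.sqrt (1 + deriv f x₁ ^ 2)) * ‖dnu f v x₁‖ ^ 2) *
          Real.sqrt (1 + deriv f x₁ ^ 2)) +
      2 * ∫ x in OmegaR f R, ‖p2 v x‖ ^ 2 =
    (R - c) * (∫ x₁ in Ioo (0 : ℝ) (2 * π),
        (‖p2 v (x₁, R)‖ ^ 2 - ‖p1 v (x₁, R)‖ ^ 2 + k ^ 2 * ‖v (x₁, R)‖ ^ 2)) +
      ∫ x in OmegaR f R, (‖p1 v x‖ ^ 2 + ‖p2 v x‖ ^ 2 - k ^ 2 * ‖v x‖ ^ 2) := by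
  have hfc := hf.continuous
  have hlt : ∀ x ∈ Icc 0 (2 * π), f x < R := fun x hx =>
    (le_csSup (isCompact_Icc.image hfc).bddAbove ⟨x, hx, rfl⟩).trans_lt hR
  have hd : Differentiable ℝ v := hv.differentiable two_ne_zero
  have hvc := hv.continuous
  have hp1 : ContDiff ℝ 1 (p1 v) := contDiff_p1 (n := 1) hv
  have hp2 : ContDiff ℝ 1 (p2 v) := contDiff_p2 (n := 1) hv
  have hc1 := hp1.continuous
  have hc2 := hp2.continuous
  have hlap : Continuous (lap v) :=
    (contDiff_p1 (n := 0) (by simpa using hp1)).continuous.add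
      (contDiff_p2 (n := 0) (by simpa using hp2)).continuous
  have hF1 := contDiff_rellichFst c hv
  have hF2 := contDiff_rellichSnd k c hv
  have hF1c := hF1.continuous
  have hF2c := hF2.continuous
  have hdf : Continuous (deriv f) := hf.continuous_deriv le_rfl
  have hG1 : Continuous fun x => fderiv ℝ (rellichFst c v) x (1, 0) :=
    (hF1.continuous_fderiv one_ne_zero).clm_apply continuous_const
  have hG2 : Continuous fun x => fderiv ℝ (rellichSnd k c v) x (0, 1) :=
    (hF2.continuous_fderiv one_ne_zero).clm_apply continuous_const
  have hW : Continuous fun x : ℝ × ℝ =>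
      ((x.2 - c : ℝ) : ℂ) * (starRingEnd ℂ) (p2 v x) * (lap v x + (k : ℂ) ^ 2 * v x) := by
    fun_prop
  have hWre := Complex.continuous_re.comp hW
  have hIoo : ∀ {g : ℝ → ℝ}, Continuous g → IntegrableOn g (Ioo 0 (2 * π)) := fun hg =>
    (hg.integrableOn_Icc (a := 0) (b := 2 * π)).mono_set Ioo_subset_Icc_self
  have hvol := setIntegral_congr_fun (μ := volume) (measurableSet_OmegaR hfc R)
    fun x _ => rellich_pointwise k c hv x
  rw [integral_add, integral_add, integral_add, integral_const_mul, integral_const_mul,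
    setIntegral_OmegaR_fderiv_fst hf (by simpa using hfper 0) hlt hF1
      (rellichFst_periodic c hd hvqp),
    setIntegral_OmegaR_fderiv_snd hfc hlt hF2,
    integral_sub (hIoo (by fun_prop)) (hIoo (by fun_prop))] at hvol
  · have hre := integral_re (integrableOn_OmegaR hfc R hW)
    simp only [RCLike.re_to_complex] at hre
    have hbd : ∀ x ∈ Ioo 0 (2 * π), _ = _ := fun x hx =>
      rellich_boundary k c (hv0 x hx)
        (p1_graph_eq (hf.differentiable one_ne_zero) hd isOpen_Ioo hv0 hx)
    have hbdi := setIntegral_congr_fun (μ := volume) measurableSet_Ioo hbd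
    rw [integral_sub (hIoo (by fun_prop)) (hIoo (by fun_prop))] at hbdi
    have htop : ∫ x in Ioo 0 (2 * π), rellichSnd k c v (x, R) = _ :=
      integral_const_mul (R - c) _
    rw [hbdi, ← hre, ← htop]
    linarith
  all_goals exact integrableOn_OmegaR hfc R (by first | exact hWre.const_mul 2 | fun_prop)
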